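/- arXiv:2409.08686 — 2 statements merged into one kernel-verified Lean document; each statement's English description precedes it below -/
import Mathlib

section
/- Let A = kQ/I be a gentle algebra and let 𝒞 = a_1a_2⋯a_l be a full-relational oriented cycle of (Q,I). Then for every 1 ≤ t ≤ l, the right Ā_{𝒞,t}-module a_tA ⊗_A Ā_{𝒞,t} is an indecomposable projective right Ā_{𝒞,t}-module; explicitly, a_tA ⊗_A Ā_{𝒞,t} ≅ ε̄_{t(a_t)}Ā_{𝒞,t}, the indecomposable projective right Ā_{𝒞,t}-module at the vertex t(a_t). -/
/- Common infrastructure: finite quivers, path algebras, gentle algebras,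
   right modules, Gorenstein projective modules, etc. -/

open MulOpposite

noncomputable section

/-- A finite quiver, with `nV` vertices and `nE` arrows. -/
structure QuiverData where
  nV : ℕ
  nE : ℕ
  src : Fin nE → Fin nV
  tgt : Fin nE → Fin nV

/-- The relations defining the path algebra `kQ` as a quotient of the free
algebra on the set of vertices and arrows:  the trivial paths `e_v` are
orthogonal idempotents summing to `1`, and `e_{s(a)} * a = a = a * e_{t(a)}`.
(Paths are composed left-to-right, matching the paper's convention.) -/
inductive PathRel (k : Type) [Field k] (Q : QuiverData) :
    FreeAlgebra k (Fin Q.nV ⊕ Fin Q.nE) → FreeAlgebra k (Fin Q.nV ⊕ Fin Q.nE) → Prop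
  | vtx_mul (v w : Fin Q.nV) : PathRel k Q
      (FreeAlgebra.ι k (Sum.inl v) * FreeAlgebra.ι k (Sum.inl w))
      (if v = w then FreeAlgebra.ι k (Sum.inl v) else 0)
  | vtx_sum : PathRel k Q (∑ v : Fin Q.nV, FreeAlgebra.ι k (Sum.inl v)) 1
  | src_arr (e : Fin Q.nE) : PathRel k Q
      (FreeAlgebra.ι k (Sum.inl (Q.src e)) * FreeAlgebra.ι k (Sum.inr e))
      (FreeAlgebra.ι k (Sum.inr e))
  | arr_tgt (e : Fin Q.nE) : PathRel k Q
      (FreeAlgebra.ι k (Sum.inr e) * FreeAlgebra.ι k (Sum.inl (Q.tgt e)))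
      (FreeAlgebra.ι k (Sum.inr e))

/-- The path algebra `kQ`. -/
def PathAlg (k : Type) [Field k] (Q : QuiverData) := RingQuot (PathRel k Q)

instance (k : Type) [Field k] (Q : QuiverData) : Ring (PathAlg k Q) :=
  inferInstanceAs (Ring (RingQuot (PathRel k Q)))

instance (k : Type) [Field k] (Q : QuiverData) : Algebra k (PathAlg k Q) :=
  inferInstanceAs (Algebra k (RingQuot (PathRel k Q)))

/-- The arrow `e`, as an element of the path algebra. -/
def arr (k : Type) [Field k] (Q : QuiverData) (e : Fin Q.nE) : PathAlg k Q :=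
  RingQuot.mkAlgHom k (PathRel k Q) (FreeAlgebra.ι k (Sum.inr e))

/-- The trivial path (idempotent) at the vertex `v`, in the path algebra. -/
def vtx (k : Type) [Field k] (Q : QuiverData) (v : Fin Q.nV) : PathAlg k Q :=
  RingQuot.mkAlgHom k (PathRel k Q) (FreeAlgebra.ι k (Sum.inl v))

/-- Given a set `Rel` of (composable) pairs of arrows, the relation on `kQ`
identifying each corresponding length-two path with `0`; the quotient is
`kQ/I` where `I` is the two-sided ideal generated by these paths of length two. -/
def GRel (k : Type) [Field k] (Q : QuiverData) (Rel : Set (Fin Q.nE × Fin Q.nE)) :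
    PathAlg k Q → PathAlg k Q → Prop := fun x y =>
  (∃ p ∈ Rel, x = arr k Q p.1 * arr k Q p.2) ∧ y = 0

/-- The algebra `A = kQ/I`. -/
def GAlg (k : Type) [Field k] (Q : QuiverData) (Rel : Set (Fin Q.nE × Fin Q.nE)) :=
  RingQuot (GRel k Q Rel)

instance (k : Type) [Field k] (Q : QuiverData) (Rel : Set (Fin Q.nE × Fin Q.nE)) :
    Ring (GAlg k Q Rel) := inferInstanceAs (Ring (RingQuot (GRel k Q Rel)))

instance (k : Type) [Field k] (Q : QuiverData) (Rel : Set (Fin Q.nE × Fin Q.nE)) :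
    Algebra k (GAlg k Q Rel) := inferInstanceAs (Algebra k (RingQuot (GRel k Q Rel)))

/-- The canonical projection `kQ → kQ/I`. -/
def gmap (k : Type) [Field k] (Q : QuiverData) (Rel : Set (Fin Q.nE × Fin Q.nE)) :
    PathAlg k Q →ₐ[k] GAlg k Q Rel := RingQuot.mkAlgHom k (GRel k Q Rel)

/-- Membership in the ideal `I` (the kernel of `kQ → kQ/I`). -/
def inI (k : Type) [Field k] (Q : QuiverData) (Rel : Set (Fin Q.nE × Fin Q.nE))
    (x : PathAlg k Q) : Prop := gmap k Q Rel x = 0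

/-- The idempotent `ε_v ∈ A` at a vertex `v`. -/
def vtxA (k : Type) [Field k] (Q : QuiverData) (Rel : Set (Fin Q.nE × Fin Q.nE))
    (v : Fin Q.nV) : GAlg k Q Rel := gmap k Q Rel (vtx k Q v)

/-- The image in `A` of an arrow `e`. -/
def arrA (k : Type) [Field k] (Q : QuiverData) (Rel : Set (Fin Q.nE × Fin Q.nE))
    (e : Fin Q.nE) : GAlg k Q Rel := gmap k Q Rel (arr k Q e)

/-- `(Q, I)` is a gentle pair (with `I` the ideal generated by the length-two
paths coming from `Rel`), and moreover `I` is admissible. -/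
structure IsGentle (k : Type) [Field k] (Q : QuiverData)
    (Rel : Set (Fin Q.nE × Fin Q.nE)) : Prop where
  /-- the generating relations are composable length-two paths -/
  comp_rel : ∀ p ∈ Rel, Q.tgt p.1 = Q.src p.2
  /-- every vertex is the source of at most two arrows -/
  src_card : ∀ v, (Finset.univ.filter fun e => Q.src e = v).card ≤ 2
  /-- every vertex is the target of at most two arrows -/
  tgt_card : ∀ v, (Finset.univ.filter fun e => Q.tgt e = v).card ≤ 2
  /-- for each arrow `a` there is at most one arrow `b` with `ab ∉ I` -/
  uniq_nonrel_right : ∀ a b c, ¬ inI k Q Rel (arr k Q a * arr k Q b) →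
    ¬ inI k Q Rel (arr k Q a * arr k Q c) → b = c
  /-- for each arrow `a` there is at most one arrow `c` with `ca ∉ I` -/
  uniq_nonrel_left : ∀ a b c, ¬ inI k Q Rel (arr k Q b * arr k Q a) →
    ¬ inI k Q Rel (arr k Q c * arr k Q a) → b = c
  /-- for each arrow `a` there is at most one (composable) arrow `b` with `ab ∈ I` -/
  uniq_rel_right : ∀ a b c, Q.tgt a = Q.src b → Q.tgt a = Q.src c →
    inI k Q Rel (arr k Q a * arr k Q b) → inI k Q Rel (arr k Q a * arr k Q c) → b = c
  /-- for each arrow `a` there is at most one (composable) arrow `c` with `ca ∈ I` -/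
  uniq_rel_left : ∀ a b c, Q.tgt b = Q.src a → Q.tgt c = Q.src a →
    inI k Q Rel (arr k Q b * arr k Q a) → inI k Q Rel (arr k Q c * arr k Q a) → b = c
  /-- admissibility: some power of the arrow ideal is contained in `I` -/
  admissible : ∃ m, 2 ≤ m ∧ ∀ f : Fin m → Fin Q.nE,
    inI k Q Rel (List.ofFn fun i => arr k Q (f i)).prod

/-- A full-relational oriented cycle `𝒞 = a_1 ⋯ a_len` (of length ≥ 3, as assumed
throughout the paper) in the bound quiver `(Q, I)`, encoded by a periodic
sequence of arrows.  `arrows i` is the arrow `a_{i+1}` (`0`-indexed),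
consecutive arrows are composable, all consecutive length-two paths lie in `I`,
and the vertices of the cycle are pairwise distinct. -/
structure FRCycle (k : Type) [Field k] (Q : QuiverData)
    (Rel : Set (Fin Q.nE × Fin Q.nE)) where
  len : ℕ
  len3 : 3 ≤ len
  arrows : ℕ → Fin Q.nE
  periodic : ∀ i, arrows (i + len) = arrows i
  comp : ∀ i, Q.tgt (arrows i) = Q.src (arrows (i + 1))
  frel : ∀ i, inI k Q Rel (arr k Q (arrows i) * arr k Q (arrows (i + 1)))
  vinj : ∀ i j, i < len → j < len → Q.src (arrows i) = Q.src (arrows j) → i = j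

/-- There are no full-relational oriented cycles of length `< 3` (the blanket
assumption of the paper). -/
def NoShortFRC (k : Type) [Field k] (Q : QuiverData)
    (Rel : Set (Fin Q.nE × Fin Q.nE)) : Prop :=
  ∀ (l : ℕ) (c : ℕ → Fin Q.nE), 1 ≤ l → (∀ i, c (i + l) = c i) →
    (∀ i, Q.tgt (c i) = Q.src (c (i + 1))) →
    (∀ i, inI k Q Rel (arr k Q (c i) * arr k Q (c (i + 1)))) → 3 ≤ l

/-- The set of arrows lying on the cycle. -/
def FRCycle.arrowSet {k : Type} [Field k] {Q : QuiverData}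
    {Rel : Set (Fin Q.nE × Fin Q.nE)} (C : FRCycle k Q Rel) : Set (Fin Q.nE) :=
  {a | ∃ i < C.len, C.arrows i = a}

/-- The idempotent `ε_{𝒞,t} ∈ A`: the sum of the `ε_v` over the vertices `v`
of the cycle `𝒞` other than `s(a_t)` and `t(a_t)`. -/
def epsCt (k : Type) [Field k] (Q : QuiverData) (Rel : Set (Fin Q.nE × Fin Q.nE))
    (C : FRCycle k Q Rel) (t : ℕ) : GAlg k Q Rel :=
  ∑ i ∈ (Finset.range C.len).filter
      (fun i => Q.src (C.arrows i) ≠ Q.src (C.arrows t) ∧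
        Q.src (C.arrows i) ≠ Q.tgt (C.arrows t)),
    vtxA k Q Rel (Q.src (C.arrows i))

/-- The relation identifying an element `ε` of a ring with `0`; the quotient is
`R/RεR`. -/
def QuotRel (R : Type) [Ring R] (ε : R) : R → R → Prop := fun x y => x = ε ∧ y = 0

/-- The quotient ring `R/RεR`. -/
def QuotBy (R : Type) [Ring R] (ε : R) := RingQuot (QuotRel R ε)

instance (R : Type) [Ring R] (ε : R) : Ring (QuotBy R ε) :=
  inferInstanceAs (Ring (RingQuot (QuotRel R ε)))

/-- The canonical projection `R → R/RεR`. -/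
def qmap (R : Type) [Ring R] (ε : R) : R →+* QuotBy R ε := RingQuot.mkRingHom (QuotRel R ε)

/-- The right ideal `xR`, as a right `R`-module (i.e. an `Rᵐᵒᵖ`-submodule of `R`). -/
def rIdeal (R : Type) [Ring R] (x : R) : Submodule Rᵐᵒᵖ R := Submodule.span Rᵐᵒᵖ {x}

/-- Restriction of scalars along `π : R →+* S` turns a right `S`-module into a
right `R`-module. -/
def modRestrict {R S : Type} [Ring R] [Ring S] (π : R →+* S) (M : Type)
    [AddCommGroup M] [Module Sᵐᵒᵖ M] : Module Rᵐᵒᵖ M :=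
  Module.compHom M (RingHom.op π)

/-- `M` is a Gorenstein projective right `R`-module:  there is a complete
resolution, i.e. an exact sequence `⋯ → P⁻² → P⁻¹ → P⁰ → P¹ → ⋯` of finitely
generated projective right `R`-modules which stays exact after applying
`Hom_R(-, R)`, with `M ≅ Im(P⁻¹ → P⁰)`. -/
def IsGProjMod (R : Type) [Ring R] (M : Type) [AddCommGroup M] [Module Rᵐᵒᵖ M] : Prop :=
  ∃ (P : ℤ → ModuleCat.{0} Rᵐᵒᵖ) (d : (n : ℤ) → (P n →ₗ[Rᵐᵒᵖ] P (n + 1))),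
    (∀ n, Module.Finite Rᵐᵒᵖ (P n)) ∧
    (∀ n, Module.Projective Rᵐᵒᵖ (P n)) ∧
    (∀ n, LinearMap.range (d n) = LinearMap.ker (d (n + 1))) ∧
    (∀ (n : ℤ) (g : P (n + 1) →ₗ[Rᵐᵒᵖ] R),
      g.comp (d n) = 0 ↔ ∃ h : P (n + 1 + 1) →ₗ[Rᵐᵒᵖ] R, h.comp (d (n + 1)) = g) ∧
    Nonempty (M ≃ₗ[Rᵐᵒᵖ] LinearMap.range (d (-1)))

/-- `M` is an indecomposable `S`-module. -/
def IsIndec (S : Type) [Ring S] (M : Type) [AddCommGroup M] [Module S M] : Prop :=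
  Nontrivial M ∧ ∀ N₁ N₂ : Submodule S M, IsCompl N₁ N₂ → N₁ = ⊥ ∨ N₂ = ⊥

/-- `M` is a non-projective indecomposable Gorenstein projective right `R`-module. -/
def IsNPIGProj (R : Type) [Ring R] (M : Type) [AddCommGroup M] [Module Rᵐᵒᵖ M] : Prop :=
  IsGProjMod R M ∧ IsIndec Rᵐᵒᵖ M ∧ ¬ Module.Projective Rᵐᵒᵖ M

/-- A right `S`-module `M`, viewed as a right `R`-module along `π : R →+* S`, is a
non-projective indecomposable Gorenstein projective right `R`-module. -/
def RestrIsNPIGProj {R S : Type} [Ring R] [Ring S] (π : R →+* S) (M : Type)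
    [AddCommGroup M] [Module Sᵐᵒᵖ M] : Prop :=
  letI := modRestrict π M
  IsNPIGProj R M

/-- The submodule `M·(RεR)` of a right `R`-module `M`;  the quotient
`M ⧸ M·(RεR)` realizes the tensor product `M ⊗_R R/RεR`. -/
def smulIdeal (R : Type) [Ring R] (ε : R) (M : Type) [AddCommGroup M]
    [Module Rᵐᵒᵖ M] : Submodule Rᵐᵒᵖ M :=
  Submodule.span Rᵐᵒᵖ {m | ∃ (x : M) (a b : R), m = (op (a * ε * b)) • x}

/-- `S` has finitely many finitely generated indecomposable modules up to
isomorphism.  (Applied with `S = Aᵐᵒᵖ` this says `A` is representation-finite.) -/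
def RepFinite (S : Type) [Ring S] : Prop :=
  ∃ (n : ℕ) (M : Fin n → ModuleCat.{0} S), ∀ N : ModuleCat.{0} S,
    Module.Finite S N → IsIndec S N → ∃ i, Nonempty (N ≃ₗ[S] M i)

/-- A cycle in the underlying undirected graph of `Q`:  a closed walk of
length ≥ 1 along edges (each traversed forwards or backwards) with pairwise
distinct vertices and pairwise distinct edges. -/
structure UCycle (Q : QuiverData) where
  len : ℕ
  len1 : 1 ≤ len
  edges : ℕ → Fin Q.nE
  dir : ℕ → Bool
  vert : ℕ → Fin Q.nV
  pe : ∀ i, edges (i + len) = edges i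
  pd : ∀ i, dir (i + len) = dir i
  pv : ∀ i, vert (i + len) = vert i
  incid_t : ∀ i, dir i = true →
    Q.src (edges i) = vert i ∧ Q.tgt (edges i) = vert (i + 1)
  incid_f : ∀ i, dir i = false →
    Q.tgt (edges i) = vert i ∧ Q.src (edges i) = vert (i + 1)
  vdist : ∀ i j, i < len → j < len → vert i = vert j → i = j
  edist : ∀ i j, i < len → j < len → edges i = edges j → i = j

/-- The set of edges of an undirected cycle. -/
def UCycle.edgeSet {Q : QuiverData} (C : UCycle Q) : Set (Fin Q.nE) :=
  {e | ∃ i < C.len, C.edges i = e}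

/-- The underlying graph of `Q` has exactly one cycle. -/
def OneCycle (Q : QuiverData) : Prop :=
  Nonempty (UCycle Q) ∧ ∀ C C' : UCycle Q, C.edgeSet = C'.edgeSet

/-- The projective dimension of (the module underlying) `M` is at most `n`. -/
def projDimLE (S : Type) [Ring S] : ℕ → ModuleCat.{0} S → Prop
  | 0, M => Module.Projective S M
  | n + 1, M => ∃ (P : ModuleCat.{0} S) (f : P →ₗ[S] M), Module.Projective S P ∧
      Function.Surjective f ∧ projDimLE S n (ModuleCat.of S (LinearMap.ker f))

/-- The injective dimension of (the module underlying) `M` is at most `n`. -/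
def injDimLE (S : Type) [Ring S] : ℕ → ModuleCat.{0} S → Prop
  | 0, M => Module.Injective S M
  | n + 1, M => ∃ (J : ModuleCat.{0} S) (f : M →ₗ[S] J), Module.Injective S J ∧
      Function.Injective f ∧ injDimLE S n (ModuleCat.of S (J ⧸ LinearMap.range f))

end

noncomputable section

section RightIdeal

variable {R : Type} [Ring R]

theorem mem_rIdeal {x y : R} : y ∈ rIdeal R x ↔ ∃ r, x * r = y := by
  rw [rIdeal, Submodule.mem_span_singleton]
  exact ⟨fun ⟨r, h⟩ => ⟨r.unop, h⟩, fun ⟨r, h⟩ => ⟨op r, h⟩⟩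

/-- Left multiplication by `x`, as a map of right modules onto `xR`. -/
def mulLeftRIdeal (x : R) : R →ₗ[Rᵐᵒᵖ] rIdeal R x where
  toFun r := ⟨x * r, mem_rIdeal.2 ⟨r, rfl⟩⟩
  map_add' r s := Subtype.ext (mul_add x r s)
  map_smul' r s := Subtype.ext (mul_assoc x s r.unop).symm

theorem mul_eq_self_of_mem_rIdeal {e x : R} (he : IsIdempotentElem e) (hx : x ∈ rIdeal R e) :
    e * x = x := by
  obtain ⟨r, rfl⟩ := mem_rIdeal.1 hx
  rw [← mul_assoc, he.eq]

theorem projective_rIdeal {e : R} (he : IsIdempotentElem e) :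
    Module.Projective Rᵐᵒᵖ (rIdeal R e) := by
  have : Module.Projective Rᵐᵒᵖ R :=
    Module.Projective.of_equiv (MulOpposite.opLinearEquiv Rᵐᵒᵖ (M := R)).symm
  refine Module.Projective.of_split (rIdeal R e).subtype (mulLeftRIdeal e) ?_
  ext x
  exact mul_eq_self_of_mem_rIdeal he x.2

/-- If `a * e = a` and left multiplication by `a` is injective on `eR`, then `eR ≃ aR`. -/
def rIdealEquiv {a e : R} (he : IsIdempotentElem e) (hae : a * e = a)
    (hinj : ∀ x, a * x = 0 → e * x = 0) : rIdeal R e ≃ₗ[Rᵐᵒᵖ] rIdeal R a :=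
  LinearEquiv.ofBijective ((mulLeftRIdeal a).comp (rIdeal R e).subtype) <| by
    constructor
    · rw [← LinearMap.ker_eq_bot, LinearMap.ker_eq_bot']
      intro x hx
      have h := hinj x (congrArg Subtype.val hx)
      rw [mul_eq_self_of_mem_rIdeal he x.2] at h
      exact Subtype.ext h
    · rintro ⟨y, hy⟩
      obtain ⟨r, rfl⟩ := mem_rIdeal.1 hy
      refine ⟨⟨e * r, mem_rIdeal.2 ⟨r, rfl⟩⟩, Subtype.ext ?_⟩
      change a * (e * r) = a * r
      rw [← mul_assoc, hae]

theorem IsIndec.of_equiv {S M N : Type} [Ring S] [AddCommGroup M] [Module S M]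
    [AddCommGroup N] [Module S N] (f : M ≃ₗ[S] N) (h : IsIndec S M) : IsIndec S N := by
  obtain ⟨_, h⟩ := h
  refine ⟨f.symm.toEquiv.nontrivial, fun N₁ N₂ hN => ?_⟩
  let g := Submodule.orderIsoMapComap f.symm
  simpa only [map_eq_bot_iff] using h (g N₁) (g N₂) (g.isCompl hN)

/-- A nonzero idempotent `e` such that `eRe` has no idempotents besides `0` and `e` generates an
indecomposable right ideal. -/
theorem isIndec_rIdeal {e : R} (he : IsIdempotentElem e) (he0 : e ≠ 0)
    (hprim : ∀ f, IsIdempotentElem f → e * f = f → f * e = f → f = 0 ∨ f = e) :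
    IsIndec Rᵐᵒᵖ (rIdeal R e) := by
  have hmem : e ∈ rIdeal R e := mem_rIdeal.2 ⟨e, he.eq⟩
  refine ⟨⟨⟨e, hmem⟩, 0, fun h => he0 (congrArg Subtype.val h)⟩, fun N₁ N₂ hN => ?_⟩
  obtain ⟨y, hy, z, hz, hyz⟩ : ∃ y ∈ N₁, ∃ z ∈ N₂, y + z = (⟨e, hmem⟩ : rIdeal R e) :=
    Submodule.mem_sup.1 (hN.sup_eq_top ▸ Submodule.mem_top)
  have hsum : (y : R) + z = e := congrArg Subtype.val hyz
  have huniq : ∀ y' ∈ N₁, ∀ z' ∈ N₂, y' + z' = y → y' = y := by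
    intro y' hy' z' hz' h
    have hz0 : z' = 0 := by
      have h1 : z' ∈ N₁ := by
        rw [← eq_sub_iff_add_eq'] at h
        exact h ▸ N₁.sub_mem hy hy'
      exact (Submodule.disjoint_def.1 hN.disjoint) z' h1 hz'
    rw [← h, hz0, add_zero]
  have hey : e * (y : R) = y := mul_eq_self_of_mem_rIdeal he y.2
  have hyy : (y : R) * y = y := by
    refine congrArg Subtype.val (huniq (op (y : R) • y) (N₁.smul_mem _ hy) (op (y : R) • z)
      (N₂.smul_mem _ hz) (Subtype.ext ?_))
    change (y : R) * y + z * y = y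
    rw [← add_mul, hsum, hey]
  have hye : (y : R) * e = y := by
    have h1 : (y : R) * z = 0 := by
      have h1 : op (z : R) • y = 0 := by
        refine (Submodule.disjoint_def.1 hN.disjoint) _ (N₁.smul_mem _ hy) ?_
        have h2 : op (z : R) • y = z - op (z : R) • z := by
          refine Subtype.ext ?_
          change (y : R) * z = z - z * z
          rw [eq_sub_iff_add_eq, ← add_mul, hsum, mul_eq_self_of_mem_rIdeal he z.2]
        rw [h2]
        exact N₂.sub_mem hz (N₂.smul_mem _ hz)
      exact congrArg Subtype.val h1
    have h2 := congrArg ((y : R) * ·) hsum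
    simpa only [mul_add, hyy, h1, add_zero] using h2.symm
  have hbot : ∀ N : Submodule Rᵐᵒᵖ (rIdeal R e), (⟨e, hmem⟩ : rIdeal R e) ∈ N → N = ⊤ := by
    refine fun N h => Submodule.eq_top_iff'.2 fun w => ?_
    have h2 : w = op (w : R) • (⟨e, hmem⟩ : rIdeal R e) :=
      Subtype.ext (mul_eq_self_of_mem_rIdeal he w.2).symm
    rw [h2]
    exact N.smul_mem _ h
  rcases hprim y hyy hey hye with h | h
  · have hy0 : y = 0 := Subtype.ext h
    rw [hy0, zero_add] at hyz
    have := hbot N₂ (hyz ▸ hz)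
    exact Or.inl (by simpa [this] using hN.inf_eq_bot)
  · have hy0 : y = ⟨e, hmem⟩ := Subtype.ext h
    have := hbot N₁ (hy0 ▸ hy)
    exact Or.inr (by simpa [this] using hN.inf_eq_bot)

end RightIdeal

section Quotient

variable {R : Type} [Ring R] {ε : R}

instance instAlgebraQuotBy {k : Type} [Field k] [Algebra k R] : Algebra k (QuotBy R ε) :=
  inferInstanceAs (Algebra k (RingQuot (QuotRel R ε)))

theorem qmap_algebraMap {k : Type} [Field k] [Algebra k R] (c : k) :
    qmap R ε (algebraMap k R c) = algebraMap k (QuotBy R ε) c := by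
  have h := RingQuot.mkAlgHom_coe k (QuotRel R ε)
  exact (DFunLike.congr_fun h _).symm.trans ((RingQuot.mkAlgHom k (QuotRel R ε)).commutes c)

theorem qmap_surjective : Function.Surjective (qmap R ε) :=
  RingQuot.mkRingHom_surjective _

theorem qmap_self : qmap R ε ε = 0 :=
  (RingQuot.mkRingHom_rel ⟨rfl, rfl⟩).trans (map_zero (qmap R ε))

theorem exists_quotBy_lift {S : Type} [Ring S] (f : R →+* S) (h : f ε = 0) :
    ∃ g : QuotBy R ε →+* S, ∀ x, g (qmap R ε x) = f x :=
  ⟨RingQuot.lift ⟨f, by rintro _ _ ⟨rfl, rfl⟩; rw [h, map_zero]⟩,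
    fun _ => RingQuot.lift_mkRingHom_apply ..⟩

end Quotient

section PathAlgebra

variable {k : Type} [Field k] {Q : QuiverData} {Rel : Set (Fin Q.nE × Fin Q.nE)}

theorem vtxA_mul (v w : Fin Q.nV) :
    vtxA k Q Rel v * vtxA k Q Rel w = if v = w then vtxA k Q Rel v else 0 := by
  have h := RingQuot.mkAlgHom_rel k (PathRel.vtx_mul (k := k) (Q := Q) v w)
  rw [map_mul] at h
  refine (map_mul (gmap k Q Rel) _ _).symm.trans ((congrArg (gmap k Q Rel) h).trans ?_)
  split_ifs
  · rfl
  · exact (congrArg (gmap k Q Rel) (map_zero _)).trans (map_zero _)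

theorem vtxA_idem (v : Fin Q.nV) : IsIdempotentElem (vtxA k Q Rel v) := by
  rw [IsIdempotentElem, vtxA_mul, if_pos rfl]

theorem sum_vtxA : ∑ v, vtxA k Q Rel v = 1 := by
  have h := RingQuot.mkAlgHom_rel k (PathRel.vtx_sum (k := k) (Q := Q))
  rw [map_sum, map_one] at h
  exact (map_sum (gmap k Q Rel) _ _).symm.trans ((congrArg (gmap k Q Rel) h).trans (map_one _))

theorem src_mul_arrA (e : Fin Q.nE) :
    vtxA k Q Rel (Q.src e) * arrA k Q Rel e = arrA k Q Rel e := by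
  have h := RingQuot.mkAlgHom_rel k (PathRel.src_arr (k := k) (Q := Q) e)
  rw [map_mul] at h
  exact (map_mul (gmap k Q Rel) _ _).symm.trans (congrArg (gmap k Q Rel) h)

theorem arrA_mul_tgt (e : Fin Q.nE) :
    arrA k Q Rel e * vtxA k Q Rel (Q.tgt e) = arrA k Q Rel e := by
  have h := RingQuot.mkAlgHom_rel k (PathRel.arr_tgt (k := k) (Q := Q) e)
  rw [map_mul] at h
  exact (map_mul (gmap k Q Rel) _ _).symm.trans (congrArg (gmap k Q Rel) h)

theorem inI_of_mem {a b : Fin Q.nE} (h : (a, b) ∈ Rel) :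
    inI k Q Rel (arr k Q a * arr k Q b) :=
  (RingQuot.mkAlgHom_rel k (s := GRel k Q Rel) ⟨⟨_, h, rfl⟩, rfl⟩).trans
    (map_zero (gmap k Q Rel))

theorem arrA_mul_arrA_of_mem {a b : Fin Q.nE} (h : (a, b) ∈ Rel) :
    arrA k Q Rel a * arrA k Q Rel b = 0 :=
  (map_mul (gmap k Q Rel) _ _).symm.trans (inI_of_mem h)

theorem GAlg.induction {P : GAlg k Q Rel → Prop} (scalar : ∀ c, P (algebraMap k _ c))
    (vertex : ∀ v, P (vtxA k Q Rel v)) (arrow : ∀ e, P (arrA k Q Rel e))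
    (add : ∀ x y, P x → P y → P (x + y)) (mul : ∀ x y, P x → P y → P (x * y)) (x) : P x := by
  obtain ⟨x, rfl⟩ := RingQuot.mkAlgHom_surjective k (GRel k Q Rel) x
  obtain ⟨x, rfl⟩ := RingQuot.mkAlgHom_surjective k (PathRel k Q) x
  let f : FreeAlgebra k (Fin Q.nV ⊕ Fin Q.nE) →ₐ[k] GAlg k Q Rel :=
    (gmap k Q Rel).comp (RingQuot.mkAlgHom k (PathRel k Q))
  change P (f x)
  induction x using FreeAlgebra.induction with
  | grade0 c => rw [AlgHom.commutes]; exact scalar c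
  | grade1 x =>
    rcases x with v | e
    · exact vertex v
    · exact arrow e
  | mul x y hx hy => rw [map_mul]; exact mul _ _ hx hy
  | add x y hx hy => rw [map_add]; exact add _ _ hx hy

/-- The universal property of `kQ/I`. -/
theorem exists_gAlg_lift {B : Type} [Ring B] [Algebra k B] (fv : Fin Q.nV → B) (fe : Fin Q.nE → B)
    (hmul : ∀ v w, fv v * fv w = if v = w then fv v else 0) (hsum : ∑ v, fv v = 1)
    (hsrc : ∀ e, fv (Q.src e) * fe e = fe e) (htgt : ∀ e, fe e * fv (Q.tgt e) = fe e)
    (hrel : ∀ a b, (a, b) ∈ Rel → fe a * fe b = 0) :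
    ∃ f : GAlg k Q Rel →ₐ[k] B,
      (∀ v, f (vtxA k Q Rel v) = fv v) ∧ ∀ e, f (arrA k Q Rel e) = fe e := by
  let f₀ : FreeAlgebra k (Fin Q.nV ⊕ Fin Q.nE) →ₐ[k] B := FreeAlgebra.lift k (Sum.elim fv fe)
  have hv : ∀ v, f₀ (FreeAlgebra.ι k (Sum.inl v)) = fv v := fun v => FreeAlgebra.lift_ι_apply ..
  have he : ∀ e, f₀ (FreeAlgebra.ι k (Sum.inr e)) = fe e := fun e => FreeAlgebra.lift_ι_apply ..
  have h₀ : ∀ ⦃x y⦄, PathRel k Q x y → f₀ x = f₀ y := by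
    intro x y h
    induction h with
    | vtx_mul v w => rw [map_mul, hv, hv, hmul]; split_ifs <;> simp [hv]
    | vtx_sum => simp [hv, hsum]
    | src_arr e => rw [map_mul, hv, he, hsrc]
    | arr_tgt e => rw [map_mul, hv, he, htgt]
  let f₁ : PathAlg k Q →ₐ[k] B := RingQuot.liftAlgHom k ⟨f₀, h₀⟩
  have hv₁ : ∀ v, f₁ (vtx k Q v) = fv v := fun v =>
    (RingQuot.liftAlgHom_mkAlgHom_apply k f₀ h₀ _).trans (hv v)
  have he₁ : ∀ e, f₁ (arr k Q e) = fe e := fun e =>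
    (RingQuot.liftAlgHom_mkAlgHom_apply k f₀ h₀ _).trans (he e)
  have h₁ : ∀ ⦃x y⦄, GRel k Q Rel x y → f₁ x = f₁ y := by
    rintro _ _ ⟨⟨p, hp, rfl⟩, rfl⟩
    rw [map_mul, he₁, he₁, hrel _ _ hp, map_zero]
  exact ⟨RingQuot.liftAlgHom k ⟨f₁, h₁⟩,
    fun v => (RingQuot.liftAlgHom_mkAlgHom_apply k f₁ h₁ _).trans (hv₁ v),
    fun e => (RingQuot.liftAlgHom_mkAlgHom_apply k f₁ h₁ _).trans (he₁ e)⟩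

/-- The character of `kQ/I` given by the simple module at `v`. -/
theorem exists_character (v : Fin Q.nV) : ∃ χ : GAlg k Q Rel →ₐ[k] k,
    (∀ w, χ (vtxA k Q Rel w) = if w = v then 1 else 0) ∧ ∀ e, χ (arrA k Q Rel e) = 0 := by
  refine exists_gAlg_lift (fun w => if w = v then 1 else 0) (fun _ => 0) ?_ ?_ ?_ ?_ ?_
  · intro u w
    by_cases h : u = w
    · subst h; simp
    · rw [if_neg h]
      by_cases hu : u = v
      · simp [← hu, Ne.symm h]
      · simp [hu]
  all_goals simp

variable (k Q Rel) in
/-- The `k`-span of the arrows. -/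
def arrowSpan : Submodule k (GAlg k Q Rel) := Submodule.span k (Set.range (arrA k Q Rel))

theorem vtxA_mul_mem_arrowSpan_mul_top (v : Fin Q.nV) {x : GAlg k Q Rel}
    (hx : x ∈ arrowSpan k Q Rel * ⊤) : vtxA k Q Rel v * x ∈ arrowSpan k Q Rel * ⊤ := by
  induction hx using Submodule.mul_induction_on' with
  | mem_mul_mem l hl y hy =>
    rw [← mul_assoc]
    refine Submodule.mul_mem_mul ?_ hy
    induction hl using Submodule.span_induction with
    | mem l hl =>
      obtain ⟨e, rfl⟩ := hl
      by_cases h : v = Q.src e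
      · rw [h, src_mul_arrA]
        exact Submodule.subset_span ⟨e, rfl⟩
      · rw [← src_mul_arrA e, ← mul_assoc, vtxA_mul, if_neg h, zero_mul]
        exact zero_mem _
    | zero => rw [mul_zero]; exact zero_mem _
    | add l l' _ _ h h' => rw [mul_add]; exact add_mem h h'
    | smul c l _ h => rw [mul_smul_comm]; exact Submodule.smul_mem _ _ h
  | add x _ y _ hx hy => rw [mul_add]; exact add_mem hx hy

theorem mul_mem_arrowSpan_mul_top {j : GAlg k Q Rel} (hj : j ∈ arrowSpan k Q Rel * ⊤)
    (x : GAlg k Q Rel) : j * x ∈ arrowSpan k Q Rel * ⊤ := by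
  have h := Submodule.mul_mem_mul hj (Submodule.mem_top (R := k) (x := x))
  rw [mul_assoc] at h
  exact (mul_le_mul' le_rfl le_top : _ ≤ arrowSpan k Q Rel * ⊤) h

theorem span_vtxA_sup_arrowSpan_mul_top :
    Submodule.span k (Set.range (vtxA k Q Rel)) ⊔ arrowSpan k Q Rel * ⊤ = ⊤ := by
  set D := Submodule.span k (Set.range (vtxA k Q Rel))
  set T := D ⊔ arrowSpan k Q Rel * ⊤
  have key : ∀ x : GAlg k Q Rel, ∀ y ∈ T, x * y ∈ T := by
    intro x
    induction x using GAlg.induction with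
    | scalar c => intro y hy; rw [← Algebra.smul_def]; exact T.smul_mem c hy
    | vertex v =>
      intro y hy
      obtain ⟨d, hd, j, hj, rfl⟩ := Submodule.mem_sup.1 hy
      rw [mul_add]
      refine Submodule.add_mem_sup ?_ (vtxA_mul_mem_arrowSpan_mul_top v hj)
      induction hd using Submodule.span_induction with
      | mem d hd =>
        obtain ⟨w, rfl⟩ := hd
        rw [vtxA_mul]
        split_ifs
        · exact Submodule.subset_span ⟨v, rfl⟩
        · exact zero_mem _
      | zero => rw [mul_zero]; exact zero_mem _
      | add l l' hl hl' h h' =>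
        rw [mul_add]
        exact add_mem (h (add_mem (Submodule.mem_sup_left hl)
          (Submodule.mem_sup_right hj))) (h' (add_mem (Submodule.mem_sup_left hl')
          (Submodule.mem_sup_right hj)))
      | smul c l hl h =>
        rw [mul_smul_comm]
        exact Submodule.smul_mem _ _ (h (add_mem (Submodule.mem_sup_left hl)
          (Submodule.mem_sup_right hj)))
    | arrow e =>
      intro y _
      exact Submodule.mem_sup_right
        (Submodule.mul_mem_mul (Submodule.subset_span ⟨e, rfl⟩) Submodule.mem_top)
    | add x x' h h' => intro y hy; rw [add_mul]; exact add_mem (h y hy) (h' y hy)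
    | mul x x' h h' => intro y hy; rw [mul_assoc]; exact h _ (h' y hy)
  refine Submodule.eq_top_iff'.2 fun x => ?_
  rw [← mul_one x, ← sum_vtxA]
  exact key x _ (Submodule.mem_sup_left (sum_mem fun v _ => Submodule.subset_span ⟨v, rfl⟩))

theorem exists_vtxA_add_arrow (x : GAlg k Q Rel) :
    ∃ d ∈ Submodule.span k (Set.range (vtxA k Q Rel)), ∃ j ∈ arrowSpan k Q Rel * ⊤, d + j = x :=
  Submodule.mem_sup.1 (span_vtxA_sup_arrowSpan_mul_top.ge Submodule.mem_top)

theorem top_mul_arrowSpan_le : ⊤ * arrowSpan k Q Rel ≤ arrowSpan k Q Rel * ⊤ := by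
  refine Submodule.mul_le.2 fun x hx l hl => ?_
  have hl' : l ∈ arrowSpan k Q Rel * ⊤ := by
    rw [← mul_one l]; exact Submodule.mul_mem_mul hl Submodule.mem_top
  obtain ⟨d, hd, j, hj, rfl⟩ := exists_vtxA_add_arrow x
  rw [add_mul]
  refine add_mem ?_ (mul_mem_arrowSpan_mul_top hj l)
  clear hx
  induction hd using Submodule.span_induction with
  | mem d hd =>
    obtain ⟨w, rfl⟩ := hd
    exact vtxA_mul_mem_arrowSpan_mul_top w hl'
  | zero => rw [zero_mul]; exact zero_mem _
  | add d d' _ _ h h' => rw [add_mul]; exact add_mem h h'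
  | smul c d _ h => rw [smul_mul_assoc]; exact Submodule.smul_mem _ _ h

theorem arrowSpan_mul_top_pow_le (n : ℕ) :
    (arrowSpan k Q Rel * ⊤) ^ n ≤ arrowSpan k Q Rel ^ n * ⊤ := by
  induction n with
  | zero => simp
  | succ n ih =>
    set L := arrowSpan k Q Rel
    calc (L * ⊤) ^ (n + 1) = (L * ⊤) ^ n * (L * ⊤) := pow_succ ..
      _ ≤ L ^ n * ⊤ * (L * ⊤) := mul_le_mul' ih le_rfl
      _ = L ^ n * (⊤ * L) * ⊤ := by simp only [mul_assoc]
      _ ≤ L ^ n * (L * ⊤) * ⊤ := mul_le_mul' (mul_le_mul' le_rfl top_mul_arrowSpan_le) le_rfl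
      _ = L ^ (n + 1) * (⊤ * ⊤) := by simp only [pow_succ, mul_assoc]
      _ ≤ L ^ (n + 1) * ⊤ := mul_le_mul' le_rfl le_top

theorem arrowSpan_pow_eq_bot {m : ℕ}
    (hm : ∀ f : Fin m → Fin Q.nE, inI k Q Rel (List.ofFn fun i => arr k Q (f i)).prod) :
    arrowSpan k Q Rel ^ m = ⊥ := by
  rw [arrowSpan, Submodule.span_pow, Submodule.span_eq_bot]
  intro x hx
  obtain ⟨f, rfl⟩ := Set.mem_pow.1 hx
  choose g hg using fun i => (f i).2
  have h : gmap k Q Rel _ = 0 := hm g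
  rw [map_list_prod, List.map_ofFn] at h
  rw [← h]
  congr 2
  funext i
  exact (hg i).symm

theorem isNilpotent_of_mem_arrowSpan_mul_top (hg : IsGentle k Q Rel) {x : GAlg k Q Rel}
    (hx : x ∈ arrowSpan k Q Rel * ⊤) : IsNilpotent x := by
  obtain ⟨m, -, hm⟩ := hg.admissible
  refine ⟨m, ?_⟩
  have h := arrowSpan_mul_top_pow_le m (Submodule.pow_mem_pow _ hx m)
  rwa [arrowSpan_pow_eq_bot hm, Submodule.bot_mul, Submodule.mem_bot] at h

/-- Every element of the corner algebra at `v` is a scalar plus a nilpotent. -/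
theorem isNilpotent_corner_sub (hg : IsGentle k Q Rel) {v : Fin Q.nV} {χ : GAlg k Q Rel →ₐ[k] k}
    (hv : ∀ w, χ (vtxA k Q Rel w) = if w = v then 1 else 0) (he : ∀ e, χ (arrA k Q Rel e) = 0)
    (x : GAlg k Q Rel) :
    IsNilpotent (vtxA k Q Rel v * x * vtxA k Q Rel v - χ x • vtxA k Q Rel v) := by
  obtain ⟨d, hd, j, hj, rfl⟩ := exists_vtxA_add_arrow x
  have hd' : vtxA k Q Rel v * d * vtxA k Q Rel v = χ d • vtxA k Q Rel v := by
    induction hd using Submodule.span_induction with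
    | mem d hd =>
      obtain ⟨w, rfl⟩ := hd
      by_cases h : w = v
      · simp [h, hv, (vtxA_idem v).eq]
      · simp [h, hv, vtxA_mul, Ne.symm h]
    | zero => simp
    | add d d' _ _ h h' => rw [mul_add, add_mul, h, h', map_add, add_smul]
    | smul c d _ h => rw [mul_smul_comm, smul_mul_assoc, h, map_smul, smul_assoc]
  have hj' : χ j = 0 := by
    have hL : arrowSpan k Q Rel ≤ LinearMap.ker χ.toLinearMap := by
      rw [arrowSpan, Submodule.span_le]
      rintro _ ⟨e, rfl⟩
      exact he e
    induction hj using Submodule.mul_induction_on' with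
    | mem_mul_mem l hl y _ =>
      rw [map_mul, show χ l = 0 from hL hl, zero_mul]
    | add x _ y _ hx hy => rw [map_add, hx, hy, add_zero]
  rw [mul_add, add_mul, hd', map_add, hj', add_zero, add_sub_cancel_left]
  exact isNilpotent_of_mem_arrowSpan_mul_top hg
    (mul_mem_arrowSpan_mul_top (vtxA_mul_mem_arrowSpan_mul_top v hj) _)

end PathAlgebra

section Cycle

variable {k : Type} [Field k] {Q : QuiverData} {Rel : Set (Fin Q.nE × Fin Q.nE)}
  (C : FRCycle k Q Rel) {t : ℕ}

theorem FRCycle.src_eq_iff (i j : ℕ) :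
    Q.src (C.arrows i) = Q.src (C.arrows j) ↔ i % C.len = j % C.len := by
  have hpos : 0 < C.len := by have := C.len3; omega
  have hmod : ∀ i, C.arrows (i % C.len) = C.arrows i := fun i =>
    Function.Periodic.map_mod_nat C.periodic i
  rw [← hmod i, ← hmod j]
  refine ⟨fun h => ?_, fun h => by rw [h]⟩
  exact C.vinj _ _ (Nat.mod_lt _ hpos) (Nat.mod_lt _ hpos) h

theorem map_epsCt_eq_zero {B : Type} [Ring B] (f : GAlg k Q Rel →+ B)
    (h : ∀ w, w ≠ Q.src (C.arrows t) → w ≠ Q.tgt (C.arrows t) → f (vtxA k Q Rel w) = 0) :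
    f (epsCt k Q Rel C t) = 0 := by
  rw [epsCt, map_sum]
  refine Finset.sum_eq_zero fun i hi => ?_
  obtain ⟨-, h1, h2⟩ := Finset.mem_filter.1 hi
  exact h _ h1 h2

theorem vtxA_mul_epsCt :
    vtxA k Q Rel (Q.src (C.arrows (t + 2))) * epsCt k Q Rel C t =
      vtxA k Q Rel (Q.src (C.arrows (t + 2))) := by
  have h3 := C.len3
  have hlt : (t + 2) % C.len < C.len := Nat.mod_lt _ (by omega)
  have hsrc : Q.src (C.arrows ((t + 2) % C.len)) = Q.src (C.arrows (t + 2)) :=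
    (C.src_eq_iff _ _).2 (Nat.mod_mod _ _)
  have hne : ∀ s d, 0 < d → d < C.len → (s + d) % C.len ≠ s % C.len := by
    intro s d hd hlt h
    have h0 := Nat.ModEq.add_left_cancel' s (show s + d ≡ s + 0 [MOD C.len] from h)
    exact Nat.not_dvd_of_pos_of_lt hd hlt (Nat.modEq_zero_iff_dvd.1 h0)
  rw [epsCt, Finset.mul_sum, Finset.sum_eq_single ((t + 2) % C.len)]
  · rw [hsrc, (vtxA_idem _).eq]
  · intro i hi hne
    rw [vtxA_mul, if_neg]
    intro h
    rw [C.src_eq_iff] at h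
    have := (Finset.mem_range.1 (Finset.mem_filter.1 hi).1)
    rw [Nat.mod_eq_of_lt this] at h
    exact hne h.symm
  · intro h
    refine absurd ?_ h
    rw [Finset.mem_filter, Finset.mem_range, hsrc, C.comp t, Ne, Ne, C.src_eq_iff, C.src_eq_iff]
    exact ⟨hlt, hne t 2 (by omega) (by omega), hne (t + 1) 1 (by omega) (by omega)⟩

theorem qmap_arrA_succ :
    qmap _ (epsCt k Q Rel C t) (arrA k Q Rel (C.arrows (t + 1))) = 0 := by
  rw [← arrA_mul_tgt, C.comp (t + 1), ← vtxA_mul_epsCt C, map_mul, map_mul, qmap_self,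
    mul_zero, mul_zero]

/-- Left multiplication by the arrow `a_t` is injective on the projective at its target, since the
matrix algebra below contains a representation in which `a_t` can be cancelled. -/
theorem mul_eq_zero_of_arrow_mul_eq_zero (hg : IsGentle k Q Rel)
    (x : QuotBy (GAlg k Q Rel) (epsCt k Q Rel C t))
    (hx : qmap _ (epsCt k Q Rel C t) (arrA k Q Rel (C.arrows t)) * x = 0) :
    qmap _ (epsCt k Q Rel C t) (vtxA k Q Rel (Q.tgt (C.arrows t))) * x = 0 := by
  set a := C.arrows t
  set π := qmap _ (epsCt k Q Rel C t)
  obtain ⟨ρ, hv, he⟩ := exists_gAlg_lift (k := k) (Rel := Rel)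
    (B := Matrix (Fin 2) (Fin 2) (QuotBy (GAlg k Q Rel) (epsCt k Q Rel C t)))
    (fun w => !![if w = Q.src a then 1 else 0, 0; 0, π (vtxA k Q Rel w)])
    (fun b => !![0, if b = a then π (vtxA k Q Rel (Q.tgt a)) else 0; 0, π (arrA k Q Rel b)])
    (by
      intro v w
      rw [Matrix.mul_fin_two, ← map_mul, vtxA_mul]
      by_cases h : v = w
      · subst h
        ext i j
        fin_cases i <;> fin_cases j <;> simp +contextual
      · have : ¬ (v = Q.src a ∧ w = Q.src a) := fun h' => h (h'.1.trans h'.2.symm)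
        ext i j
        fin_cases i <;> fin_cases j <;> simp [h]
        tauto)
    (by
      ext i j
      rw [Matrix.sum_apply]
      fin_cases i <;> fin_cases j <;> simp [← map_sum, sum_vtxA])
    (by
      intro e
      rw [Matrix.mul_fin_two, ← map_mul, src_mul_arrA]
      by_cases h : e = a
      · subst h; simp
      · simp [h])
    (by
      intro e
      rw [Matrix.mul_fin_two, ← map_mul, arrA_mul_tgt]
      by_cases h : e = a
      · subst h; simp [← map_mul, (vtxA_idem _).eq]
      · simp [h])
    (by
      intro b c hbc
      rw [Matrix.mul_fin_two, ← map_mul, arrA_mul_arrA_of_mem hbc]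
      by_cases h : b = a
      · subst h
        have hc : c = C.arrows (t + 1) :=
          hg.uniq_rel_right _ _ _ (hg.comp_rel _ hbc) (C.comp t) (inI_of_mem hbc) (C.frel t)
        have : π (arrA k Q Rel c) = 0 := hc ▸ qmap_arrA_succ C
        ext i j
        fin_cases i <;> fin_cases j <;> simp [this]
      · ext i j
        fin_cases i <;> fin_cases j <;> simp [h])
  have hrow : ∀ y, ρ y 1 0 = 0 ∧ ρ y 1 1 = π y := by
    intro y
    induction y using GAlg.induction with
    | scalar c =>
      rw [AlgHom.commutes, qmap_algebraMap]
      simp [Matrix.algebraMap_matrix_apply]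
    | vertex v => simp [hv]
    | arrow e => simp [he]
    | add y z hy hz => simp [hy, hz]
    | mul y z hy hz => simp [Matrix.mul_apply, Fin.sum_univ_two, hy, hz]
  obtain ⟨σ, hσ⟩ := exists_quotBy_lift (ε := epsCt k Q Rel C t) ρ.toRingHom (by
    ext i j
    fin_cases i
    · let f := (Matrix.entryAddMonoidHom _ 0 j).comp ρ.toRingHom.toAddMonoidHom
      refine map_epsCt_eq_zero C f fun w hw _ => ?_
      change ρ (vtxA k Q Rel w) 0 j = 0
      rw [hv, if_neg hw]
      fin_cases j <;> rfl
    · fin_cases j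
      · exact (hrow _).1
      · exact (hrow _).2.trans qmap_self)
  obtain ⟨y, rfl⟩ := qmap_surjective x
  rw [← map_mul] at hx
  have h := hσ (arrA k Q Rel a * y)
  rw [hx, map_zero] at h
  have h01 : (ρ (arrA k Q Rel a * y)) 0 1 = 0 := by
    have := congrFun (congrFun h.symm 0) 1
    exact this
  rw [map_mul, Matrix.mul_apply, Fin.sum_univ_two, he, (hrow y).2] at h01
  simpa using h01

theorem eq_zero_or_eq_of_corner_idempotent (hg : IsGentle k Q Rel)
    {v : Fin Q.nV} {ε : GAlg k Q Rel} {χ : GAlg k Q Rel →ₐ[k] k}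
    (hv : ∀ w, χ (vtxA k Q Rel w) = if w = v then 1 else 0) (he : ∀ e, χ (arrA k Q Rel e) = 0)
    (hε : χ ε = 0) (f : QuotBy (GAlg k Q Rel) ε) (hf : IsIdempotentElem f)
    (hl : qmap _ ε (vtxA k Q Rel v) * f = f) (hr : f * qmap _ ε (vtxA k Q Rel v) = f) :
    f = 0 ∨ f = qmap _ ε (vtxA k Q Rel v) := by
  obtain ⟨χ', hχ'⟩ := exists_quotBy_lift χ.toRingHom hε
  obtain ⟨x, rfl⟩ := qmap_surjective f
  have hχ : χ x = 0 ∨ χ x = 1 := by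
    have h := hf.map χ'
    rw [hχ'] at h
    exact IsIdempotentElem.iff_eq_zero_or_one.1 h
  have hn := (isNilpotent_corner_sub hg hv he x).map (qmap _ ε)
  rw [map_sub, map_mul, map_mul, hl, hr] at hn
  rcases hχ with h | h
  · rw [h, zero_smul, map_zero, sub_zero] at hn
    exact Or.inl (hf.eq_zero_of_isNilpotent hn)
  · rw [h, one_smul, ← neg_sub, isNilpotent_neg_iff] at hn
    refine Or.inr (sub_eq_zero.1 ?_).symm
    refine IsIdempotentElem.eq_zero_of_isNilpotent ?_ hn
    have hi := ((vtxA_idem (k := k) (Rel := Rel) v).map (qmap _ ε)).eq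
    rw [IsIdempotentElem, mul_sub, sub_mul, sub_mul, hi, hl, hr, hf.eq, sub_self, sub_zero]

end Cycle

end

/-- Lemma `lemm:idemp`.  Let `A = kQ/I` be a gentle algebra and
`𝒞 = a_1 ⋯ a_l` a full-relational oriented cycle.  Then for every `t`
(`0`-indexed, `t < l`), the right `Ā_{𝒞,t}`-module `a_tA ⊗_A Ā_{𝒞,t}` — which is
canonically the right ideal `ā_t Ā_{𝒞,t}` — is an indecomposable projective
right `Ā_{𝒞,t}`-module, isomorphic to `ε̄_{t(a_t)} Ā_{𝒞,t}`, the indecomposable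
projective right `Ā_{𝒞,t}`-module at the vertex `t(a_t)`. -/
theorem stmt0 (k : Type) [Field k] [IsAlgClosed k] (Q : QuiverData)
    (Rel : Set (Fin Q.nE × Fin Q.nE)) (hgentle : IsGentle k Q Rel)
    (hfd : Module.Finite k (GAlg k Q Rel)) (hns : NoShortFRC k Q Rel)
    (C : FRCycle k Q Rel) (t : ℕ) (ht : t < C.len) :
    let A := GAlg k Q Rel
    let ε := epsCt k Q Rel C t
    let Abar := QuotBy A ε
    let atbar : Abar := qmap A ε (arrA k Q Rel (C.arrows t))
    let etbar : Abar := qmap A ε (vtxA k Q Rel (Q.tgt (C.arrows t)))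
    IsIndec Abarᵐᵒᵖ ↥(rIdeal Abar atbar) ∧
      Module.Projective Abarᵐᵒᵖ ↥(rIdeal Abar atbar) ∧
      Nonempty (↥(rIdeal Abar atbar) ≃ₗ[Abarᵐᵒᵖ] ↥(rIdeal Abar etbar)) := by
  intro A ε Abar atbar etbar
  have hidem : IsIdempotentElem etbar := (vtxA_idem _).map (qmap A ε)
  have hae : atbar * etbar = atbar := by
    rw [← map_mul, arrA_mul_tgt]
  obtain ⟨χ, hv, he⟩ := exists_character (k := k) (Rel := Rel) (Q.tgt (C.arrows t))
  have hε : χ ε = 0 :=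
    map_epsCt_eq_zero C (χ : _ →+ k) fun w _ hw => (hv w).trans (if_neg hw)
  have hne : etbar ≠ 0 := by
    obtain ⟨χ', hχ'⟩ := exists_quotBy_lift χ.toRingHom hε
    intro h
    have h1 := hχ' (vtxA k Q Rel (Q.tgt (C.arrows t)))
    change χ' etbar = χ _ at h1
    rw [h, map_zero, hv, if_pos rfl] at h1
    exact zero_ne_one h1
  let φ := rIdealEquiv hidem hae (mul_eq_zero_of_arrow_mul_eq_zero C hgentle)
  have hproj := projective_rIdeal hidem
  exact ⟨(isIndec_rIdeal hidem hne
    (eq_zero_or_eq_of_corner_idempotent hgentle hv he hε)).of_equiv φ,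
    Module.Projective.of_equiv φ, ⟨φ.symm⟩⟩
end

section
/- Let A = kQ/I be a gentle algebra and let 𝒞 = a_1⋯a_l be a full-relational oriented cycle of (Q,I), 1 ≤ t ≤ l. Then ε̄_{t(a_t)} Ā_{𝒞,t} ε̄_{s(a_t)} = 0; equivalently, every path of length ≥ 1 in Q from t(a_t) to s(a_t) which avoids all vertices of 𝒞 other than s(a_t) and t(a_t) lies in I. In particular a_t Ā_{𝒞,t} ε̄_{s(a_t)} = 0, i.e. no nonzero element of Ā_{𝒞,t} of the form a_t·p̄ ends at the vertex s(a_t). -/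
/- Common infrastructure: finite quivers, path algebras, gentle algebras,
   right modules, Gorenstein projective modules, etc. -/

open MulOpposite

namespace QuiverData

variable {k : Type} [Field k] {Q : QuiverData} {Rel : Set (Fin Q.nE × Fin Q.nE)}

theorem vtx_mul_vtx (v w : Fin Q.nV) :
    vtx k Q v * vtx k Q w = if v = w then vtx k Q v else 0 := by
  have h := RingQuot.mkAlgHom_rel k (PathRel.vtx_mul (k := k) v w)
  rw [map_mul, apply_ite (RingQuot.mkAlgHom k (PathRel k Q)), map_zero] at h
  exact h

theorem vtx_src_mul_arr (e : Fin Q.nE) : vtx k Q (Q.src e) * arr k Q e = arr k Q e := by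
  have h := RingQuot.mkAlgHom_rel k (PathRel.src_arr (k := k) e)
  rw [map_mul] at h
  exact h

theorem arr_mul_vtx_tgt (e : Fin Q.nE) : arr k Q e * vtx k Q (Q.tgt e) = arr k Q e := by
  have h := RingQuot.mkAlgHom_rel k (PathRel.arr_tgt (k := k) e)
  rw [map_mul] at h
  exact h

theorem vtxA_mul_vtxA (v w : Fin Q.nV) :
    vtxA k Q Rel v * vtxA k Q Rel w = if v = w then vtxA k Q Rel v else 0 := by
  rw [vtxA, vtxA, ← map_mul, vtx_mul_vtx]
  split_ifs <;> simp

theorem vtxA_src_mul_arrA (e : Fin Q.nE) :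
    vtxA k Q Rel (Q.src e) * arrA k Q Rel e = arrA k Q Rel e := by
  rw [vtxA, arrA, ← map_mul, vtx_src_mul_arr]

theorem arrA_mul_vtxA_tgt (e : Fin Q.nE) :
    arrA k Q Rel e * vtxA k Q Rel (Q.tgt e) = arrA k Q Rel e := by
  rw [vtxA, arrA, ← map_mul, arr_mul_vtx_tgt]

theorem vtxA_mul_arrA_of_ne {v : Fin Q.nV} {e : Fin Q.nE} (h : v ≠ Q.src e) :
    vtxA k Q Rel v * arrA k Q Rel e = 0 := by
  rw [← vtxA_src_mul_arrA, ← mul_assoc, vtxA_mul_vtxA, if_neg h, zero_mul]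

theorem arrA_mul_vtxA_of_ne {v : Fin Q.nV} {e : Fin Q.nE} (h : Q.tgt e ≠ v) :
    arrA k Q Rel e * vtxA k Q Rel v = 0 := by
  rw [← arrA_mul_vtxA_tgt, mul_assoc, vtxA_mul_vtxA, if_neg h, mul_zero]

theorem inI_arr_mul_arr_iff (a b : Fin Q.nE) :
    inI k Q Rel (arr k Q a * arr k Q b) ↔ arrA k Q Rel a * arrA k Q Rel b = 0 := by
  rw [inI, map_mul]
  rfl

theorem arrA_mul_arrA_of_ne {a b : Fin Q.nE} (h : Q.tgt a ≠ Q.src b) :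
    arrA k Q Rel a * arrA k Q Rel b = 0 := by
  rw [← arrA_mul_vtxA_tgt, mul_assoc, vtxA_mul_arrA_of_ne h, mul_zero]

theorem arrA_mul_arrA_of_mem {p : Fin Q.nE × Fin Q.nE} (h : p ∈ Rel) :
    arrA k Q Rel p.1 * arrA k Q Rel p.2 = 0 := by
  have := RingQuot.mkAlgHom_rel k
    (show GRel k Q Rel (arr k Q p.1 * arr k Q p.2) 0 from ⟨⟨p, h, rfl⟩, rfl⟩)
  rw [map_zero] at this
  exact (inI_arr_mul_arr_iff _ _).1 this

/-- The operators by which vertices and arrows act on functions along an infinite path `c`. -/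
def walkOp (k : Type) [Field k] (Q : QuiverData) (c : ℕ → Fin Q.nE) :
    Fin Q.nV ⊕ Fin Q.nE → Module.End k (ℕ → k)
  | .inl v =>
    { toFun := fun f i => if Q.src (c i) = v then f i else 0
      map_add' := fun f g => by ext i; simp only [Pi.add_apply]; split_ifs <;> simp
      map_smul' := fun r f => by ext i; simp }
  | .inr e =>
    { toFun := fun f i => if c i = e then f (i + 1) else 0
      map_add' := fun f g => by ext i; simp only [Pi.add_apply]; split_ifs <;> simp
      map_smul' := fun r f => by ext i; simp }

theorem walkOp_inl_apply (c : ℕ → Fin Q.nE) (v : Fin Q.nV) (f : ℕ → k) (i : ℕ) :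
    walkOp k Q c (.inl v) f i = if Q.src (c i) = v then f i else 0 := rfl

theorem walkOp_inr_apply (c : ℕ → Fin Q.nE) (e : Fin Q.nE) (f : ℕ → k) (i : ℕ) :
    walkOp k Q c (.inr e) f i = if c i = e then f (i + 1) else 0 := rfl

/-- An infinite path none of whose length-two subpaths is a relation gives a representation
of `kQ/I`. -/
theorem exists_walk_rep (c : ℕ → Fin Q.nE) (hcomp : ∀ i, Q.tgt (c i) = Q.src (c (i + 1)))
    (hrel : ∀ i, (c i, c (i + 1)) ∉ Rel) :
    ∃ ρ : GAlg k Q Rel →ₐ[k] Module.End k (ℕ → k),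
      ∀ e, ρ (arrA k Q Rel e) = walkOp k Q c (.inr e) := by
  have h₁ : ∀ ⦃x y⦄, PathRel k Q x y →
      FreeAlgebra.lift k (walkOp k Q c) x = FreeAlgebra.lift k (walkOp k Q c) y := by
    intro x y h
    induction h with
    | vtx_mul v w =>
      rw [map_mul, apply_ite (FreeAlgebra.lift k (walkOp k Q c)), map_zero]
      simp only [FreeAlgebra.lift_ι_apply]
      ext f i
      simp only [Module.End.mul_apply, walkOp_inl_apply]
      split_ifs <;> simp_all [walkOp_inl_apply]
    | vtx_sum =>
      rw [map_sum, map_one]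
      simp only [FreeAlgebra.lift_ι_apply]
      ext f i
      simp [LinearMap.sum_apply, Finset.sum_apply, walkOp_inl_apply]
    | src_arr e =>
      rw [map_mul]
      simp only [FreeAlgebra.lift_ι_apply]
      ext f i
      simp only [Module.End.mul_apply, walkOp_inl_apply, walkOp_inr_apply]
      split_ifs <;> simp_all
    | arr_tgt e =>
      rw [map_mul]
      simp only [FreeAlgebra.lift_ι_apply]
      ext f i
      simp only [Module.End.mul_apply, walkOp_inl_apply, walkOp_inr_apply, ← hcomp]
      split_ifs <;> simp_all
  let ψ : PathAlg k Q →ₐ[k] Module.End k (ℕ → k) :=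
    RingQuot.liftAlgHom k ⟨FreeAlgebra.lift k (walkOp k Q c), h₁⟩
  have hψ : ∀ e, ψ (arr k Q e) = walkOp k Q c (.inr e) := fun e =>
    (RingQuot.liftAlgHom_mkAlgHom_apply k _ h₁ _).trans (FreeAlgebra.lift_ι_apply _ _)
  have h₂ : ∀ ⦃x y⦄, GRel k Q Rel x y → ψ x = ψ y := by
    rintro x y ⟨⟨p, hp, rfl⟩, rfl⟩
    rw [map_mul, map_zero, hψ, hψ]
    ext f i
    simp only [Module.End.mul_apply, walkOp_inr_apply, LinearMap.zero_apply, Pi.zero_apply]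
    split_ifs with h h'
    · exact absurd (show (c i, c (i + 1)) ∈ Rel by rwa [h, h']) (hrel i)
    · rfl
    · rfl
  exact ⟨RingQuot.liftAlgHom k ⟨ψ, h₂⟩, fun e =>
    (RingQuot.liftAlgHom_mkAlgHom_apply k ψ h₂ _).trans (hψ e)⟩

/-- If some power of the arrow ideal lies in `I`, every infinite sequence of arrows contains a
length-two subpath lying in `I`. -/
theorem exists_arrA_mul_arrA_eq_zero
    (hadm : ∃ m, 2 ≤ m ∧ ∀ f : Fin m → Fin Q.nE,
      inI k Q Rel (List.ofFn fun i => arr k Q (f i)).prod) (c : ℕ → Fin Q.nE) :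
    ∃ i, arrA k Q Rel (c i) * arrA k Q Rel (c (i + 1)) = 0 := by
  by_contra! hc
  obtain ⟨m, -, hm⟩ := hadm
  obtain ⟨ρ, hρ⟩ := exists_walk_rep (k := k) (Rel := Rel) c
    (fun i => by by_contra h; exact hc i (arrA_mul_arrA_of_ne h))
    (fun i h => hc i (arrA_mul_arrA_of_mem h))
  have key : ∀ n j, (List.ofFn fun i : Fin n => walkOp k Q c (.inr (c (j + i)))).prod
      (fun _ => 1) j = 1 := by
    intro n
    induction n with
    | zero => simp
    | succ n ih =>
      intro j
      have := ih (j + 1)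
      simp only [List.ofFn_succ, List.prod_cons, Module.End.mul_apply, walkOp_inr_apply,
        Fin.val_zero, add_zero, if_true, Fin.val_succ]
      simpa only [add_assoc, add_comm, add_left_comm] using this
  have h0 := congrArg ρ (hm fun i => c (0 + i))
  rw [map_list_prod, map_list_prod, List.map_ofFn, List.map_ofFn, map_zero] at h0
  have h1 : (List.ofFn fun i : Fin m => walkOp k Q c (.inr (c (0 + i)))).prod = 0 := by
    rw [← h0]
    congr 2
    ext1 i
    exact (hρ _).symm
  have h2 := key m 0
  rw [h1] at h2
  exact zero_ne_one h2

theorem isChain_of_prod_ne_zero {l : List (Fin Q.nE)}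
    (h : (l.map (arrA k Q Rel)).prod ≠ 0) :
    l.IsChain fun a b => arrA k Q Rel a * arrA k Q Rel b ≠ 0 := by
  induction l with
  | nil => exact .nil
  | cons a l ih =>
    rw [List.map_cons, List.prod_cons] at h
    have hl := ih (right_ne_zero_of_mul h)
    cases l with
    | nil => exact .singleton a
    | cons b l =>
      rw [List.map_cons, List.prod_cons, ← mul_assoc] at h
      exact List.isChain_cons_cons.2 ⟨left_ne_zero_of_mul h, hl⟩

/-- If some power of the arrow ideal lies in `I`, a nonempty path without relations cannot be
closed up without a relation at the junction. -/
theorem arrA_getLast_mul_arrA_head_eq_zero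
    (hadm : ∃ m, 2 ≤ m ∧ ∀ f : Fin m → Fin Q.nE,
      inI k Q Rel (List.ofFn fun i => arr k Q (f i)).prod) {l : List (Fin Q.nE)} (hl : l ≠ [])
    (hchain : l.IsChain fun a b => arrA k Q Rel a * arrA k Q Rel b ≠ 0) :
    arrA k Q Rel (l.getLast hl) * arrA k Q Rel (l.head hl) = 0 := by
  by_contra hne
  have hpos : 0 < l.length := List.length_pos_iff.2 hl
  obtain ⟨i, hi⟩ := exists_arrA_mul_arrA_eq_zero hadm
    fun i => l[i % l.length]'(Nat.mod_lt _ hpos)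
  have hlt := Nat.mod_lt i hpos
  by_cases h : i % l.length + 1 < l.length
  · have hmod : (i + 1) % l.length = i % l.length + 1 := by
      rw [Nat.add_mod, Nat.mod_eq_of_lt (show 1 < l.length by omega), Nat.mod_eq_of_lt h]
    simp only [hmod] at hi
    exact List.isChain_iff_getElem.1 hchain _ h hi
  · have hlast : i % l.length = l.length - 1 := by omega
    have hmod : (i + 1) % l.length = 0 := by
      rw [← Nat.mod_add_mod, hlast, Nat.sub_add_cancel hpos, Nat.mod_self]
    simp only [hmod, hlast] at hi
    rw [List.getLast_eq_getElem, List.head_eq_getElem] at hne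
    exact hne hi

/-- Every element of `ε_v A` is a linear combination of `ε_v` times products of arrows. -/
theorem vtxA_mul_mem_span (v : Fin Q.nV) (x : GAlg k Q Rel) :
    vtxA k Q Rel v * x ∈ Submodule.span k
      (Set.range fun l : List (Fin Q.nE) => vtxA k Q Rel v * (l.map (arrA k Q Rel)).prod) := by
  set S := Submodule.span k
    (Set.range fun l : List (Fin Q.nE) => vtxA k Q Rel v * (l.map (arrA k Q Rel)).prod)
  have hgen : ∀ l : List (Fin Q.nE), vtxA k Q Rel v * (l.map (arrA k Q Rel)).prod ∈ S :=
    fun l => Submodule.subset_span ⟨l, rfl⟩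
  let φ : FreeAlgebra k (Fin Q.nV ⊕ Fin Q.nE) →ₐ[k] GAlg k Q Rel :=
    (gmap k Q Rel).comp (RingQuot.mkAlgHom k (PathRel k Q))
  have hφ : Function.Surjective φ :=
    (RingQuot.mkAlgHom_surjective k (GRel k Q Rel)).comp
      (RingQuot.mkAlgHom_surjective k (PathRel k Q))
  have closed : ∀ z, ∀ y ∈ S, y * φ z ∈ S := by
    intro z
    induction z using FreeAlgebra.induction with
    | grade0 r =>
      intro y hy
      rw [AlgHom.commutes, ← Algebra.commutes, ← Algebra.smul_def]
      exact S.smul_mem r hy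
    | grade1 g =>
      intro y hy
      induction hy using Submodule.span_induction with
      | zero => rw [zero_mul]; exact S.zero_mem
      | add a b _ _ ha hb => rw [add_mul]; exact S.add_mem ha hb
      | smul r a _ ha => rw [smul_mul_assoc]; exact S.smul_mem r ha
      | mem y hy =>
        obtain ⟨l, rfl⟩ := hy
        cases g with
        | inr e =>
          have := hgen (l ++ [e])
          rw [List.map_append, List.prod_append, ← mul_assoc, List.map_singleton,
            List.prod_singleton] at this
          exact this
        | inl w =>
          change vtxA k Q Rel v * (l.map (arrA k Q Rel)).prod * vtxA k Q Rel w ∈ S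
          rcases List.eq_nil_or_concat l with rfl | ⟨l, e, rfl⟩
          · have := hgen []
            rw [List.map_nil, List.prod_nil, mul_one] at this ⊢
            rw [vtxA_mul_vtxA]
            split_ifs
            exacts [this, S.zero_mem]
          · have := hgen (l ++ [e])
            rw [List.concat_eq_append]
            rw [List.map_append, List.prod_append, List.map_singleton,
              List.prod_singleton] at this ⊢
            rw [mul_assoc, mul_assoc]
            by_cases h : Q.tgt e = w
            · rwa [← h, arrA_mul_vtxA_tgt]
            · rw [arrA_mul_vtxA_of_ne h, mul_zero, mul_zero]
              exact S.zero_mem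
    | mul a b ha hb =>
      intro y hy
      rw [map_mul, ← mul_assoc]
      exact hb _ (ha _ hy)
    | add a b ha hb =>
      intro y hy
      rw [map_add, mul_add]
      exact S.add_mem (ha _ hy) (hb _ hy)
  obtain ⟨z, rfl⟩ := hφ x
  refine closed z _ ?_
  have := hgen []
  rwa [List.map_nil, List.prod_nil, mul_one] at this

end QuiverData

namespace FRCycle

open QuiverData

variable {k : Type} [Field k] {Q : QuiverData} {Rel : Set (Fin Q.nE × Fin Q.nE)}
  (C : FRCycle k Q Rel)

theorem arrows_mod (i : ℕ) : C.arrows (i % C.len) = C.arrows i :=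
  Function.Periodic.map_mod_nat C.periodic i

theorem modEq_of_src_eq {i j : ℕ} (h : Q.src (C.arrows i) = Q.src (C.arrows j)) :
    i ≡ j [MOD C.len] := by
  have hpos : 0 < C.len := by have := C.len3; omega
  rw [← C.arrows_mod i, ← C.arrows_mod j] at h
  exact C.vinj _ _ (Nat.mod_lt _ hpos) (Nat.mod_lt _ hpos) h

theorem src_ne_of_lt {i j : ℕ} (hij : i < j) (hj : j < i + C.len) :
    Q.src (C.arrows i) ≠ Q.src (C.arrows j) := by
  intro h
  have hdvd := (Nat.modEq_iff_dvd' hij.le).1 (C.modEq_of_src_eq h)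
  have := Nat.le_of_dvd (by omega) hdvd
  omega

theorem qmap_vtxA_eq_zero {t i : ℕ} (hs : Q.src (C.arrows i) ≠ Q.src (C.arrows t))
    (ht : Q.src (C.arrows i) ≠ Q.tgt (C.arrows t)) :
    qmap (GAlg k Q Rel) (epsCt k Q Rel C t) (vtxA k Q Rel (Q.src (C.arrows i))) = 0 := by
  have hpos : 0 < C.len := by have := C.len3; omega
  have hε : qmap (GAlg k Q Rel) (epsCt k Q Rel C t) (epsCt k Q Rel C t) = 0 :=
    (RingQuot.mkRingHom_rel (r := QuotRel _ (epsCt k Q Rel C t)) ⟨rfl, rfl⟩).trans (map_zero _)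
  rw [← C.arrows_mod i] at hs ht ⊢
  have hmul : vtxA k Q Rel (Q.src (C.arrows (i % C.len))) * epsCt k Q Rel C t =
      vtxA k Q Rel (Q.src (C.arrows (i % C.len))) := by
    rw [epsCt, Finset.mul_sum, Finset.sum_eq_single (i % C.len)]
    · rw [vtxA_mul_vtxA, if_pos rfl]
    · intro j hj hne
      rw [vtxA_mul_vtxA, if_neg]
      intro h
      exact hne (C.vinj _ _ (Nat.mod_lt _ hpos)
        (Finset.mem_range.1 (Finset.mem_filter.1 hj).1) h).symm
    · intro h
      exact absurd (Finset.mem_filter.2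
        ⟨Finset.mem_range.2 (Nat.mod_lt _ hpos), hs, ht⟩) h
  rw [← hmul, map_mul, hε, mul_zero]

theorem qmap_prod_arrA_mul_eq_zero (hgentle : IsGentle k Q Rel) (t : ℕ)
    (l : List (Fin Q.nE)) :
    qmap (GAlg k Q Rel) (epsCt k Q Rel C t)
      (vtxA k Q Rel (Q.tgt (C.arrows t)) * (l.map (arrA k Q Rel)).prod *
        vtxA k Q Rel (Q.src (C.arrows t))) = 0 := by
  have hlen := C.len3
  set π := qmap (GAlg k Q Rel) (epsCt k Q Rel C t)
  set a := C.arrows t with ha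
  by_contra hne
  rcases eq_or_ne l [] with rfl | hl
  · rw [List.map_nil, List.prod_nil, mul_one, vtxA_mul_vtxA, if_neg, map_zero] at hne
    · exact hne rfl
    · rw [ha, C.comp]
      exact (C.src_ne_of_lt (by omega) (by omega)).symm
  have hprod : (l.map (arrA k Q Rel)).prod ≠ 0 := by
    rintro h
    rw [h, mul_zero, zero_mul, map_zero] at hne
    exact hne rfl
  have hchain := isChain_of_prod_ne_zero hprod
  have hhead : Q.tgt a = Q.src (l.head hl) ∧ π (arrA k Q Rel (l.head hl)) ≠ 0 := by
    rw [← List.cons_head_tail hl, List.map_cons, List.prod_cons] at hne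
    constructor
    · by_contra h
      rw [← mul_assoc, vtxA_mul_arrA_of_ne h, zero_mul, zero_mul, map_zero] at hne
      exact hne rfl
    · intro h
      simp only [map_mul, h, zero_mul, mul_zero] at hne
      exact hne trivial
  have hlast : Q.tgt (l.getLast hl) = Q.src a ∧ π (arrA k Q Rel (l.getLast hl)) ≠ 0 := by
    rw [← List.dropLast_append_getLast hl, List.map_append, List.prod_append,
      List.map_singleton, List.prod_singleton] at hne
    constructor
    · by_contra h
      rw [mul_assoc, mul_assoc, arrA_mul_vtxA_of_ne h, mul_zero, mul_zero, map_zero] at hne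
      exact hne rfl
    · intro h
      simp only [map_mul, h, zero_mul, mul_zero] at hne
      exact hne trivial
  have hjoin : arrA k Q Rel a * arrA k Q Rel (l.head hl) ≠ 0 := by
    intro h
    have heq := hgentle.uniq_rel_right a _ _ hhead.1 (C.comp t)
      ((inI_arr_mul_arr_iff _ _).2 h) (C.frel t)
    refine hhead.2 ?_
    rw [heq, ← arrA_mul_vtxA_tgt, C.comp, map_mul, C.qmap_vtxA_eq_zero, mul_zero]
    · exact (C.src_ne_of_lt (by omega) (by omega)).symm
    · rw [C.comp]
      exact (C.src_ne_of_lt (by omega) (by omega)).symm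
  have hclose : arrA k Q Rel (l.getLast hl) * arrA k Q Rel a ≠ 0 := by
    intro h
    have hsucc : C.arrows (t + (C.len - 1) + 1) = a := by
      rw [show t + (C.len - 1) + 1 = t + C.len by omega, C.periodic]
    have hcomp := C.comp (t + (C.len - 1))
    have hfrel := C.frel (t + (C.len - 1))
    rw [hsucc] at hcomp hfrel
    have heq := hgentle.uniq_rel_left a _ _ hlast.1 hcomp
      ((inI_arr_mul_arr_iff _ _).2 h) hfrel
    refine hlast.2 ?_
    rw [heq, ← vtxA_src_mul_arrA, map_mul, C.qmap_vtxA_eq_zero, zero_mul]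
    · exact (C.src_ne_of_lt (by omega) (by omega)).symm
    · rw [C.comp]
      exact (C.src_ne_of_lt (by omega) (by omega)).symm
  refine hclose ?_
  have := arrA_getLast_mul_arrA_head_eq_zero hgentle.admissible (List.cons_ne_nil a l)
    (hchain.cons_of_ne_nil hl hjoin)
  rwa [List.getLast_cons hl, List.head_cons] at this

end FRCycle

/-- Let `A = kQ/I` be a gentle algebra and `𝒞 = a_1 ⋯ a_l` a
full-relational oriented cycle, `t < l`.  Then `ε̄_{t(a_t)} Ā_{𝒞,t} ε̄_{s(a_t)} = 0`;
in particular `a_t Ā_{𝒞,t} ε̄_{s(a_t)} = 0`, i.e. no nonzero element of `Ā_{𝒞,t}`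
of the form `a_t·p̄` ends at the vertex `s(a_t)`. -/
theorem stmt1 (k : Type) [Field k] [IsAlgClosed k] (Q : QuiverData)
    (Rel : Set (Fin Q.nE × Fin Q.nE)) (hgentle : IsGentle k Q Rel)
    (hfd : Module.Finite k (GAlg k Q Rel)) (hns : NoShortFRC k Q Rel)
    (C : FRCycle k Q Rel) (t : ℕ) (ht : t < C.len) :
    let A := GAlg k Q Rel
    let ε := epsCt k Q Rel C t
    let π := qmap A ε
    (∀ x : A, π (vtxA k Q Rel (Q.tgt (C.arrows t))) * π x *
        π (vtxA k Q Rel (Q.src (C.arrows t))) = 0) ∧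
      (∀ x : A, π (arrA k Q Rel (C.arrows t)) * π x *
        π (vtxA k Q Rel (Q.src (C.arrows t))) = 0) := by
  intro A ε π
  have hmain : ∀ x : A, π (vtxA k Q Rel (Q.tgt (C.arrows t))) * π x *
      π (vtxA k Q Rel (Q.src (C.arrows t))) = 0 := by
    intro x
    rw [← map_mul]
    have hx := QuiverData.vtxA_mul_mem_span (Q.tgt (C.arrows t)) x
    generalize vtxA k Q Rel (Q.tgt (C.arrows t)) * x = y at hx
    induction hx using Submodule.span_induction with
    | zero => rw [map_zero, zero_mul]
    | add a b _ _ ha hb => rw [map_add, add_mul, ha, hb, add_zero]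
    | smul r a _ ha => rw [Algebra.smul_def, map_mul, mul_assoc, ha, mul_zero]
    | mem y hy =>
      obtain ⟨l, rfl⟩ := hy
      rw [← map_mul]
      exact C.qmap_prod_arrA_mul_eq_zero hgentle t l
  refine ⟨hmain, fun x => ?_⟩
  rw [← QuiverData.arrA_mul_vtxA_tgt, map_mul, mul_assoc, mul_assoc,
    ← mul_assoc (π (vtxA k Q Rel (Q.tgt (C.arrows t)))), hmain, mul_zero]
end
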